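/- arXiv:2208.02835 — 5 statements merged into one kernel-verified Lean document; each statement's English description precedes it below -/
import Mathlib

section
/- Consider an N-player game in which each player i's cost function has the separable pairwise form J_i(a) = α·S_i(a_i) + β·Σ_{k≠i} P_{i,k}(a_i, a_k), where α and β are real numbers, S_i : E_i → ℝ depends only on player i's own strategy, and the pairwise interaction functions satisfy the symmetry condition P_{j,k}(x, y) = P_{k,j}(y, x) for all players j ≠ k, all x ∈ E_j and all y ∈ E_k. Define F : (∀ i, E_i) → ℝ by F(a) = α·Σ_j S_j(a_j) + β·Σ_j Σ_{k<j} P_{j,k}(a_j, a_k), where the double sum ranges over pairs of players with k < j in the canonical linear order on Fin N. Then F is an exact potential function for the game: for every player i, every strategy profile a, and all b, c ∈ E_i, J_i(b, a_{−i}) − J_i(c, a_{−i}) = F(b, a_{−i}) − F(c, a_{−i}). -/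
theorem pair_sum_split {N : ℕ} (g : Fin N → Fin N → ℝ)
    (hg : ∀ j k, j ≠ k → g j k = g k j) (i : Fin N) :
    ∑ j, ∑ k ∈ Finset.univ.filter (fun k => k < j), g j k
      = ∑ k ∈ Finset.univ.erase i, g i k
        + ∑ j ∈ Finset.univ.erase i,
            ∑ k ∈ (Finset.univ.filter (fun k => k < j)).erase i, g j k := by
  have h1 : ∀ j ∈ Finset.univ.erase i,
      ∑ k ∈ Finset.univ.filter (fun k => k < j), g j k
        = (if i < j then g i j else 0)
          + ∑ k ∈ (Finset.univ.filter (fun k => k < j)).erase i, g j k := by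
    intro j hj
    have hji : j ≠ i := Finset.ne_of_mem_erase hj
    by_cases h : i < j
    · rw [if_pos h, ← hg j i hji]
      exact (Finset.add_sum_erase _ _ (by simp [h])).symm
    · rw [if_neg h, zero_add, Finset.erase_eq_of_notMem (by simp [h])]
  have h2 : ∑ k ∈ Finset.univ.filter (fun k => k < i), g i k
      = ∑ k ∈ Finset.univ.erase i, if k < i then g i k else 0 := by
    rw [← Finset.sum_filter]
    refine Finset.sum_congr ?_ fun _ _ => rfl
    ext k
    simp only [Finset.mem_filter, Finset.mem_univ, Finset.mem_erase, true_and, and_true]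
    exact ⟨fun h => ⟨h.ne, h⟩, fun h => h.2⟩
  rw [← Finset.add_sum_erase _ _ (Finset.mem_univ i), Finset.sum_congr rfl h1,
    Finset.sum_add_distrib, h2, ← add_assoc, ← Finset.sum_add_distrib]
  congr 1
  refine Finset.sum_congr rfl fun k hk => ?_
  have hki : k ≠ i := Finset.ne_of_mem_erase hk
  rcases lt_or_gt_of_ne hki with h | h
  · simp [h, h.not_gt]
  · simp [h, h.not_gt]

/-- Theorem 1 / Theorem 6 in the cited reference.
If each player's cost function has the separable pairwise form
`J i a = α * S i (a i) + β * ∑_{k ≠ i} P i k (a i) (a k)` with symmetric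
pairwise interactions, then
`F a = α * ∑ j, S j (a j) + β * ∑ j, ∑_{k < j} P j k (a j) (a k)`
is an exact potential function for the game. -/
theorem separable_pairwise_costs_admit_exact_potential
    {N : ℕ} {E : Fin N → Type*}
    [∀ i, NormedAddCommGroup (E i)] [∀ i, NormedSpace ℝ (E i)]
    (α β : ℝ)
    (S : ∀ i : Fin N, E i → ℝ)
    (P : ∀ j k : Fin N, E j → E k → ℝ)
    (hsym : ∀ j k : Fin N, j ≠ k → ∀ (x : E j) (y : E k), P j k x y = P k j y x)
    (J : Fin N → (∀ i, E i) → ℝ)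
    (hJ : ∀ (i : Fin N) (a : ∀ i, E i),
      J i a = α * S i (a i) + β * ∑ k ∈ Finset.univ.erase i, P i k (a i) (a k))
    (F : (∀ i, E i) → ℝ)
    (hF : ∀ a : ∀ i, E i,
      F a = α * ∑ j, S j (a j)
        + β * ∑ j, ∑ k ∈ Finset.univ.filter (fun k => k < j), P j k (a j) (a k)) :
    ∀ (i : Fin N) (a : ∀ i, E i) (b c : E i),
      J i (Function.update a i b) - J i (Function.update a i c)
        = F (Function.update a i b) - F (Function.update a i c) := by
  intro i a b c
  have key : ∀ x : ∀ i, E i, F x = J i x + (α * ∑ j ∈ Finset.univ.erase i, S j (x j)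
      + β * ∑ j ∈ Finset.univ.erase i,
          ∑ k ∈ (Finset.univ.filter (fun k => k < j)).erase i, P j k (x j) (x k)) := by
    intro x
    rw [hF, hJ, pair_sum_split (fun j k => P j k (x j) (x k))
      (fun j k h => hsym j k h _ _) i, ← Finset.add_sum_erase _ _ (Finset.mem_univ i)]
    ring
  have hu : ∀ (y : E i) (j : Fin N), j ≠ i → Function.update a i y j = a j :=
    fun y j h => Function.update_of_ne h _ _
  have hS : ∀ y : E i, ∑ j ∈ Finset.univ.erase i, S j (Function.update a i y j)
      = ∑ j ∈ Finset.univ.erase i, S j (a j) := fun y =>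
    Finset.sum_congr rfl fun j hj => by rw [hu y j (Finset.ne_of_mem_erase hj)]
  have hP : ∀ y : E i, ∑ j ∈ Finset.univ.erase i,
          ∑ k ∈ (Finset.univ.filter (fun k => k < j)).erase i,
            P j k (Function.update a i y j) (Function.update a i y k)
      = ∑ j ∈ Finset.univ.erase i,
          ∑ k ∈ (Finset.univ.filter (fun k => k < j)).erase i, P j k (a j) (a k) := fun y =>
    Finset.sum_congr rfl fun j hj => Finset.sum_congr rfl fun k hk => by
      rw [hu y j (Finset.ne_of_mem_erase hj), hu y k (Finset.ne_of_mem_erase hk)]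
  rw [key, key, hS, hS, hP, hP]
  ring
end

section
/- Consider an N-player game with strategy sets 𝒜_i ⊆ E_i, each nonempty and compact, that admits an exact potential function F which is continuous on the product set ∏𝒜 = {a : ∀ i, a_i ∈ 𝒜_i}. Then the game has at least one pure-strategy Nash equilibrium: there exists a profile a* with a*_i ∈ 𝒜_i for all i such that for every player i and every b ∈ 𝒜_i, J_i(a*) ≤ J_i(b, a*_{−i}). -/
/-- existence of a pure-strategy Nash equilibrium.
A game with nonempty compact strategy sets that admits an exact potential
function which is continuous on the product strategy set has at least one
pure-strategy Nash equilibrium. -/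
theorem potential_game_exists_PSNE
    {N : ℕ} {E : Fin N → Type*}
    [∀ i, NormedAddCommGroup (E i)] [∀ i, NormedSpace ℝ (E i)]
    (𝒜 : ∀ i : Fin N, Set (E i))
    (hne : ∀ i, (𝒜 i).Nonempty)
    (hcpt : ∀ i, IsCompact (𝒜 i))
    (J : Fin N → (∀ i, E i) → ℝ)
    (F : (∀ i, E i) → ℝ)
    (hpot : ∀ (i : Fin N) (a : ∀ i, E i) (b c : E i),
      J i (Function.update a i b) - J i (Function.update a i c)
        = F (Function.update a i b) - F (Function.update a i c))
    (hcont : ContinuousOn F (Set.pi Set.univ 𝒜)) :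
    ∃ a : ∀ i, E i, (∀ i, a i ∈ 𝒜 i) ∧
      ∀ i : Fin N, ∀ b ∈ 𝒜 i, J i a ≤ J i (Function.update a i b) := by
  obtain ⟨a, ha, hmin⟩ := (isCompact_univ_pi hcpt).exists_isMinOn
    (Set.univ_pi_nonempty_iff.2 hne) hcont
  have ha' : ∀ i, a i ∈ 𝒜 i := fun i => ha i (Set.mem_univ i)
  refine ⟨a, ha', fun i b hb => ?_⟩
  have hmem : Function.update a i b ∈ Set.pi Set.univ 𝒜 := by
    intro j _
    by_cases h : j = i
    · subst h
      simpa using hb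
    · simpa [Function.update_of_ne h] using ha' j
  have h1 : F a ≤ F (Function.update a i b) := isMinOn_iff.1 hmin _ hmem
  have h2 := hpot i a b (a i)
  rw [Function.update_eq_self] at h2
  linarith
end

section
/- Let E_i, i ∈ Fin N, be real normed vector spaces, let 𝒜_i ⊆ E_i be convex sets, and let ∏𝒜 = {a ∈ ∏ i, E_i : ∀ i, a_i ∈ 𝒜_i}. Let F : (∏ i, E_i) → ℝ be convex on ∏𝒜 and differentiable at a point a ∈ ∏𝒜. If a is a coordinate-wise minimizer of F, i.e., for every player i and every b ∈ 𝒜_i, F(a) ≤ F(b, a_{−i}), then a is a global minimizer of F over ∏𝒜: F(a) ≤ F(b) for all b ∈ ∏𝒜. -/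
/-- If `F` is convex on the product of convex sets `𝒜 i` and differentiable at a
point `a` of that product, and `a` is a coordinate-wise minimizer of `F`
(no player can improve by unilaterally changing its own strategy within its
strategy set), then `a` is a global minimizer of `F` over the product set. -/
theorem coordinatewise_min_of_convex_is_global_min
    {N : ℕ} {E : Fin N → Type*}
    [∀ i, NormedAddCommGroup (E i)] [∀ i, NormedSpace ℝ (E i)]
    (𝒜 : ∀ i : Fin N, Set (E i))
    (hconv : ∀ i, Convex ℝ (𝒜 i))
    (F : (∀ i, E i) → ℝ)
    (hF : ConvexOn ℝ (Set.pi Set.univ 𝒜) F)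
    (a : ∀ i, E i)
    (ha : a ∈ Set.pi Set.univ 𝒜)
    (hdiff : DifferentiableAt ℝ F a)
    (hcoord : ∀ i : Fin N, ∀ b ∈ 𝒜 i, F a ≤ F (Function.update a i b)) :
    ∀ b ∈ Set.pi Set.univ 𝒜, F a ≤ F b := by
  intro b hb
  have hstep : ∀ i, 0 ≤ fderiv ℝ F a (Pi.single i (b i - a i)) := by
    intro i
    have hmin : IsMinOn F (segment ℝ a (Function.update a i (b i))) a := by
      rintro x ⟨s, t, hs, ht, hst, rfl⟩
      have hx : s • a + t • Function.update a i (b i)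
          = Function.update a i (s • a i + t • b i) := by
        ext j
        by_cases hj : j = i
        · subst hj; simp
        · simp [hj, ← add_smul, hst]
      have := hcoord i (s • a i + t • b i)
        (hconv i (ha i (Set.mem_univ i)) (hb i (Set.mem_univ i)) hs ht hst)
      rw [← hx] at this
      exact this
    have h := hmin.localize.hasFDerivWithinAt_nonneg
      hdiff.hasFDerivAt.hasFDerivWithinAt
      (sub_mem_posTangentConeAt_of_segment_subset subset_rfl)
    have he : Function.update a i (b i) - a = Pi.single i (b i - a i) := by
      ext j
      by_cases hj : j = i
      · subst hj; simp
      · simp [hj]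
    rwa [he] at h
  have hsum : 0 ≤ fderiv ℝ F a (b - a) := by
    rw [← Finset.univ_sum_single (b - a), map_sum]
    exact Finset.sum_nonneg fun i _ => hstep i
  have hg := hF.comp_affineMap (AffineMap.lineMap (k := ℝ) a b)
  have hd : HasDerivAt (F ∘ AffineMap.lineMap (k := ℝ) a b) (fderiv ℝ F a (b - a)) (0 : ℝ) := by
    apply HasFDerivAt.comp_hasDerivAt
    · simpa using hdiff.hasFDerivAt
    · exact AffineMap.hasDerivAt_lineMap
  have := hg.le_slope_of_hasDerivAt (x := 0) (y := 1) (by simpa using ha) (by simpa using hb)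
    one_pos hd
  rw [map_sub] at hsum
  simp [slope_def_field] at this
  linarith
end

section
/- Consider an N-player game in which each strategy set 𝒜_i ⊆ E_i is nonempty, compact, and convex, and which admits an exact potential function F that is continuous on the product set ∏𝒜 = {a : ∀ i, a_i ∈ 𝒜_i}, strictly convex on ∏𝒜, and differentiable at every point of ∏𝒜. Then the game has exactly one pure-strategy Nash equilibrium in ∏𝒜. -/
/-- existence and uniqueness of the PSNE.
A game with nonempty, compact, convex strategy sets admitting an exact
potential function `F` that is continuous on the product strategy set,
strictly convex on it, and differentiable at every point of it, has exactly
one pure-strategy Nash equilibrium. -/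
theorem strictly_convex_potential_game_unique_PSNE
    {N : ℕ} {E : Fin N → Type*}
    [∀ i, NormedAddCommGroup (E i)] [∀ i, NormedSpace ℝ (E i)]
    (𝒜 : ∀ i : Fin N, Set (E i))
    (hne : ∀ i, (𝒜 i).Nonempty)
    (hcpt : ∀ i, IsCompact (𝒜 i))
    (hconv : ∀ i, Convex ℝ (𝒜 i))
    (J : Fin N → (∀ i, E i) → ℝ)
    (F : (∀ i, E i) → ℝ)
    (hpot : ∀ (i : Fin N) (a : ∀ i, E i) (b c : E i),
      J i (Function.update a i b) - J i (Function.update a i c)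
        = F (Function.update a i b) - F (Function.update a i c))
    (hcont : ContinuousOn F (Set.pi Set.univ 𝒜))
    (hstrict : StrictConvexOn ℝ (Set.pi Set.univ 𝒜) F)
    (hdiff : ∀ a ∈ Set.pi Set.univ 𝒜, DifferentiableAt ℝ F a) :
    ∃! a : ∀ i, E i, (∀ i, a i ∈ 𝒜 i) ∧
      ∀ i : Fin N, ∀ b ∈ 𝒜 i, J i a ≤ J i (Function.update a i b) := by
  have hpi : ∀ a : ∀ i, E i, a ∈ Set.pi Set.univ 𝒜 ↔ ∀ i, a i ∈ 𝒜 i := fun a => by simp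
  have hupd : ∀ a : ∀ i, E i, a ∈ Set.pi Set.univ 𝒜 → ∀ i, ∀ b ∈ 𝒜 i,
      Function.update a i b ∈ Set.pi Set.univ 𝒜 := by
    intro a ha i b hb
    rw [hpi] at ha ⊢
    intro j
    by_cases h : j = i
    · subst h; simpa using hb
    · simpa [h] using ha j
  have hJF : ∀ (a : ∀ i, E i) (i : Fin N) (b : E i),
      J i a ≤ J i (Function.update a i b) ↔ F a ≤ F (Function.update a i b) := by
    intro a i b
    have h := hpot i a b (a i)
    rw [Function.update_eq_self] at h
    constructor <;> intro _ <;> linarith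
  have hmin : ∀ a : ∀ i, E i, (∀ i, a i ∈ 𝒜 i) →
      (∀ i : Fin N, ∀ b ∈ 𝒜 i, J i a ≤ J i (Function.update a i b)) →
      IsMinOn F (Set.pi Set.univ 𝒜) a := by
    intro a ha hN
    have haS := (hpi a).2 ha
    have hF := (hdiff a haS).hasFDerivAt
    rw [isMinOn_iff]
    intro b hb
    have hb' := (hpi b).1 hb
    have hcoord : ∀ i, 0 ≤ fderiv ℝ F a (Pi.single i (b i - a i)) := by
      intro i
      have hsub : Function.update a i (b i) - a = Pi.single i (b i - a i) := by
        ext j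
        by_cases h : j = i
        · subst h; simp
        · simp [h]
      rw [← hsub]
      have hm : IsMinOn F (segment ℝ a (Function.update a i (b i))) a := by
        rw [isMinOn_iff]
        intro x hx
        rw [segment_eq_image_lineMap] at hx
        obtain ⟨t, ht, rfl⟩ := hx
        have he : AffineMap.lineMap a (Function.update a i (b i)) t
            = Function.update a i (AffineMap.lineMap (a i) (b i) t) := by
          ext j
          by_cases h : j = i
          · subst h; simp [AffineMap.lineMap_apply]
          · simp [h, AffineMap.lineMap_apply]
        rw [he, ← hJF]
        exact hN i _ ((hconv i).lineMap_mem (ha i) (hb' i) ht)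
      exact hm.localize.hasFDerivWithinAt_nonneg hF.hasFDerivWithinAt
        (sub_mem_posTangentConeAt_of_segment_subset subset_rfl)
    have hdir : 0 ≤ fderiv ℝ F a (b - a) := by
      have hs : b - a = ∑ i, Pi.single i (b i - a i) :=
        (Finset.univ_sum_single (b - a)).symm
      rw [hs, map_sum]
      exact Finset.sum_nonneg fun i _ => hcoord i
    have hg : ConvexOn ℝ (Set.Icc (0:ℝ) 1) (F ∘ (AffineMap.lineMap a b : ℝ →ᵃ[ℝ] _)) :=
      (hstrict.convexOn.comp_affineMap _).subset
        (fun t ht => hstrict.1.lineMap_mem haS hb ht) (convex_Icc _ _)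
    have hd : HasDerivAt (F ∘ (AffineMap.lineMap a b : ℝ →ᵃ[ℝ] _)) (fderiv ℝ F a (b - a)) 0 := by
      refine HasFDerivAt.comp_hasDerivAt (0:ℝ) (l := F) ?_ AffineMap.hasDerivAt_lineMap
      simpa using hF
    have h := hg.le_slope_of_hasDerivAt (by simp) (by simp) zero_lt_one hd
    have h := hdir.trans h
    simp [slope_def_field] at h
    linarith
  have hSne : (Set.pi Set.univ 𝒜).Nonempty := Set.univ_pi_nonempty_iff.2 hne
  obtain ⟨a, haS, ha⟩ := (isCompact_univ_pi hcpt).exists_isMinOn hSne hcont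
  refine ⟨a, ⟨(hpi a).1 haS, fun i b hb => (hJF a i b).2 (ha (hupd a haS i b hb))⟩, ?_⟩
  rintro c ⟨hc, hcN⟩
  exact hstrict.eq_of_isMinOn (hmin c hc hcN) ha ((hpi c).2 hc) haS
end

section
/- Consider an N-player game with strategy sets 𝒜_i ⊆ E_i and cost functions J_i that admits an exact potential function F. Let (a^n)_{n ∈ ℕ} be a best-response dynamics sequence: each a^n satisfies a^n_i ∈ 𝒜_i for all i, and for each n there exist a player i_n and a strategy b ∈ 𝒜_{i_n} such that a^{n+1} = (b, a^n_{−i_n}) and b is a best response, i.e., J_{i_n}(a^{n+1}) ≤ J_{i_n}(c, a^n_{−i_n}) for all c ∈ 𝒜_{i_n}. Then the sequence of potential values (F(a^n))_{n ∈ ℕ} is nonincreasing; moreover, if F is bounded below on the product set ∏𝒜 = {a : ∀ i, a_i ∈ 𝒜_i}, then the sequence (F(a^n)) converges. -/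
/-- convergence of best-response dynamics in a potential
game. Along any best-response dynamics sequence, the potential values are
nonincreasing; if moreover the potential is bounded below on the product
strategy set, the potential values converge. -/
theorem best_response_dynamics_potential_monotone_and_converges
    {N : ℕ} {E : Fin N → Type*}
    [∀ i, NormedAddCommGroup (E i)] [∀ i, NormedSpace ℝ (E i)]
    (𝒜 : ∀ i : Fin N, Set (E i))
    (J : Fin N → (∀ i, E i) → ℝ)
    (F : (∀ i, E i) → ℝ)
    (hpot : ∀ (i : Fin N) (a : ∀ i, E i) (b c : E i),
      J i (Function.update a i b) - J i (Function.update a i c)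
        = F (Function.update a i b) - F (Function.update a i c))
    (a : ℕ → ∀ i, E i)
    (hmem : ∀ n, ∀ i, a n i ∈ 𝒜 i)
    (hbr : ∀ n : ℕ, ∃ (i : Fin N) (b : E i), b ∈ 𝒜 i ∧
      a (n + 1) = Function.update (a n) i b ∧
      ∀ c ∈ 𝒜 i, J i (a (n + 1)) ≤ J i (Function.update (a n) i c)) :
    Antitone (fun n => F (a n)) ∧
      ((∃ m : ℝ, ∀ b : ∀ i, E i, (∀ i, b i ∈ 𝒜 i) → m ≤ F b) →
        ∃ L : ℝ, Filter.Tendsto (fun n => F (a n)) Filter.atTop (nhds L)) := by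
  have hanti : Antitone (fun n => F (a n)) := by
    refine antitone_nat_of_succ_le fun n => ?_
    obtain ⟨i, b, _, hab, hle⟩ := hbr n
    have h1 := hle (a n i) (hmem n i)
    have h2 := hpot i (a n) b (a n i)
    rw [← hab] at h2
    rw [Function.update_eq_self] at h1 h2
    linarith
  refine ⟨hanti, ?_⟩
  rintro ⟨m, hm⟩
  refine ⟨_, tendsto_atTop_ciInf hanti ⟨m, ?_⟩⟩
  rintro _ ⟨n, rfl⟩
  exact hm _ (hmem n)
end
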